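/- arXiv:2009.02592 — 2 statements merged into one kernel-verified Lean document; each statement's English description precedes it below -/
import Mathlib

section
/- If the Lr (a,τ) interval exchange transformation T is irreducible and satisfies the Keane Condition, then (X,S) is a minimal subshift: X is a closed shift-invariant subset of Ω and the closure of every S-orbit in X equals X. -/
open Set

noncomputable section

/-- `bpt a k = a_1 + ⋯ + a_k` (0-indexed: the sum of the first `k` entries of `a`);
these are the division points `b_k` of the interval exchange. -/
def bpt {n : ℕ} (a : Fin n → ℝ) (k : ℕ) : ℝ :=
  ∑ j ∈ Finset.univ.filter (fun j : Fin n => (j : ℕ) < k), a j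

/-- The left-closed right-open interval `J_i = [b_{i-1}, b_i)` (0-indexed). -/
def Jint {n : ℕ} (a : Fin n → ℝ) (i : Fin n) : Set ℝ :=
  Set.Ico (bpt a (i : ℕ)) (bpt a ((i : ℕ) + 1))

/-- The left-open right-closed interval `J̃_i = (b_{i-1}, b_i]` (0-indexed). -/
def Jtil {n : ℕ} (a : Fin n → ℝ) (i : Fin n) : Set ℝ :=
  Set.Ioc (bpt a (i : ℕ)) (bpt a ((i : ℕ) + 1))

/-- The permuted probability vector `a^τ`, with `a^τ_{τ(i)} = a_i`. -/
def aperm {n : ℕ} (a : Fin n → ℝ) (τ : Equiv.Perm (Fin n)) : Fin n → ℝ :=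
  fun j => a (τ.symm j)

/-- The set `D = {b_1, …, b_{n-1}}` of interior division points. -/
def Dset {n : ℕ} (a : Fin n → ℝ) : Set ℝ :=
  {x | ∃ k : ℕ, 0 < k ∧ k < n ∧ x = bpt a k}

/-- `a` is a positive probability vector. -/
def IsProbVec {n : ℕ} (a : Fin n → ℝ) : Prop :=
  (∀ i, 0 < a i) ∧ ∑ i, a i = 1

/-- `T` is the Lr `(a,τ)` interval exchange transformation: on each
`J_i = [b_{i-1}, b_i)` it is the translation `x ↦ x - b_{i-1} + b^τ_{τ(i)-1}`. -/
def IsLrIET {n : ℕ} (a : Fin n → ℝ) (τ : Equiv.Perm (Fin n)) (T : ℝ → ℝ) : Prop :=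
  ∀ i : Fin n, ∀ x ∈ Jint a i, T x = x - bpt a (i : ℕ) + bpt (aperm a τ) ((τ i : ℕ))

/-- `Tt` is the dual lR `(a,τ)` interval exchange transformation: on each
`J̃_i = (b_{i-1}, b_i]` it is the translation `x ↦ x - b_{i-1} + b^τ_{τ(i)-1}`. -/
def IslRIET {n : ℕ} (a : Fin n → ℝ) (τ : Equiv.Perm (Fin n)) (Tt : ℝ → ℝ) : Prop :=
  ∀ i : Fin n, ∀ x ∈ Jtil a i, Tt x = x - bpt a (i : ℕ) + bpt (aperm a τ) ((τ i : ℕ))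

/-- The Keane Condition: `D ∩ T^k(D) = ∅` for every positive integer `k`. -/
def KeaneCond {n : ℕ} (a : Fin n → ℝ) (T : ℝ → ℝ) : Prop :=
  ∀ k : ℕ, 0 < k → Dset a ∩ (T^[k] '' Dset a) = ∅

/-- `τ` is irreducible: `τ({1,…,j}) ≠ {1,…,j}` for `j = 1, …, n-1` (0-indexed:
no proper initial segment is invariant). -/
def IrreduciblePerm {n : ℕ} (τ : Equiv.Perm (Fin n)) : Prop :=
  ∀ j : ℕ, 0 < j → j < n →
    (fun i => τ i) '' {i : Fin n | (i : ℕ) < j} ≠ {i : Fin n | (i : ℕ) < j}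

/-- `P` is the family of ℤ-iterates of `T` on `[0,1)`: `P 0 = id`,
`P (k+1) = T ∘ P k`, and each `P k` maps `[0,1)` into itself. -/
def IsZIterLr (T : ℝ → ℝ) (P : ℤ → ℝ → ℝ) : Prop :=
  (∀ x ∈ Set.Ico (0 : ℝ) 1, P 0 x = x) ∧
  ∀ k : ℤ, ∀ x ∈ Set.Ico (0 : ℝ) 1, P k x ∈ Set.Ico (0 : ℝ) 1 ∧ P (k + 1) x = T (P k x)

/-- `Pt` is the family of ℤ-iterates of `Tt` on `(0,1]`. -/
def IsZIterlR (Tt : ℝ → ℝ) (Pt : ℤ → ℝ → ℝ) : Prop :=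
  (∀ x ∈ Set.Ioc (0 : ℝ) 1, Pt 0 x = x) ∧
  ∀ k : ℤ, ∀ x ∈ Set.Ioc (0 : ℝ) 1, Pt k x ∈ Set.Ioc (0 : ℝ) 1 ∧ Pt (k + 1) x = Tt (Pt k x)

/-- `I` is the itinerary map of `T` (with ℤ-iterates `P`):
`𝓘(x)_k = i ↔ T^k x ∈ J_i` for `x ∈ [0,1)`. -/
def IsItin {n : ℕ} (a : Fin n → ℝ) (P : ℤ → ℝ → ℝ) (I : ℝ → ℤ → Fin n) : Prop :=
  ∀ x ∈ Set.Ico (0 : ℝ) 1, ∀ k : ℤ, ∀ i : Fin n, (I x k = i ↔ P k x ∈ Jint a i)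

/-- `It` is the itinerary map of `Tt` (with ℤ-iterates `Pt`):
`𝓘̃(x)_k = i ↔ T̃^k x ∈ J̃_i` for `x ∈ (0,1]`. -/
def IsItinDual {n : ℕ} (a : Fin n → ℝ) (Pt : ℤ → ℝ → ℝ) (It : ℝ → ℤ → Fin n) : Prop :=
  ∀ x ∈ Set.Ioc (0 : ℝ) 1, ∀ k : ℤ, ∀ i : Fin n, (It x k = i ↔ Pt k x ∈ Jtil a i)

/-- `D_∞ = {0,1} ∪ ⋃_{k ∈ ℤ} T^k(D)`. -/
def Dinf {n : ℕ} (a : Fin n → ℝ) (P : ℤ → ℝ → ℝ) : Set ℝ :=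
  {0, 1} ∪ ⋃ k : ℤ, P k '' Dset a

/-- The set `R = [0,1] ∖ D_∞` of regular points. -/
def Rset {n : ℕ} (a : Fin n → ℝ) (P : ℤ → ℝ → ℝ) : Set ℝ :=
  Set.Icc 0 1 \ Dinf a P

/-- The shift `S` on `Ω = {1,…,n}^ℤ`: `S(α)_i = α_{i+1}`. -/
def shiftS {n : ℕ} (α : ℤ → Fin n) : ℤ → Fin n := fun i => α (i + 1)

/-- The `k`-th power of the shift: `(S^k α)_i = α_{i+k}`. -/
def shiftZ {n : ℕ} (k : ℤ) (α : ℤ → Fin n) : ℤ → Fin n := fun i => α (i + k)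

/-- `α, β` are positively asymptotic: `α_i = β_i` for all `i ≥ N`, some `N`. -/
def PosAsymp {n : ℕ} (α β : ℤ → Fin n) : Prop :=
  ∃ N : ℕ, ∀ i : ℤ, (N : ℤ) ≤ i → α i = β i

/-- `α, β` are negatively asymptotic: `α_i = β_i` for all `i ≤ -N`, some `N`. -/
def NegAsymp {n : ℕ} (α β : ℤ → Fin n) : Prop :=
  ∃ N : ℕ, ∀ i : ℤ, i ≤ -(N : ℤ) → α i = β i

open Filter Topology

section BreakPoints

variable {n : ℕ} {a : Fin n → ℝ}

lemma bpt_zero (a : Fin n → ℝ) : bpt a 0 = 0 := by simp [bpt]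

lemma bpt_succ (a : Fin n → ℝ) (i : Fin n) : bpt a ((i : ℕ) + 1) = bpt a i + a i := by
  have h : Finset.univ.filter (fun j : Fin n => (j : ℕ) < (i : ℕ) + 1) =
      insert i (Finset.univ.filter (fun j : Fin n => (j : ℕ) < (i : ℕ))) := by
    ext j
    simp only [Finset.mem_filter, Finset.mem_univ, true_and, Finset.mem_insert, Fin.ext_iff]
    omega
  rw [bpt, h, Finset.sum_insert (by simp), bpt, add_comm]

lemma IsProbVec.bpt_last (ha : IsProbVec a) : bpt a n = 1 := by
  rw [← ha.2, bpt, Finset.filter_true_of_mem (fun j _ => j.2)]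

lemma IsProbVec.bpt_mono (ha : IsProbVec a) : Monotone (bpt a) := fun j k hjk =>
  Finset.sum_le_sum_of_subset_of_nonneg
    (fun i hi => by
      simp only [Finset.mem_filter, Finset.mem_univ, true_and] at hi ⊢
      omega)
    (fun i _ _ => (ha.1 i).le)

lemma IsProbVec.bpt_lt (ha : IsProbVec a) (i : Fin n) : bpt a i < bpt a ((i : ℕ) + 1) := by
  rw [bpt_succ]
  linarith [ha.1 i]

lemma IsProbVec.bpt_nonneg (ha : IsProbVec a) (k : ℕ) : 0 ≤ bpt a k := by
  simpa [bpt_zero] using ha.bpt_mono (Nat.zero_le k)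

lemma IsProbVec.bpt_le_one (ha : IsProbVec a) {k : ℕ} (hk : k ≤ n) : bpt a k ≤ 1 := by
  simpa [ha.bpt_last] using ha.bpt_mono hk

lemma IsProbVec.bpt_pos (ha : IsProbVec a) {k : ℕ} (hk : 0 < k) (hkn : k ≤ n) :
    0 < bpt a k := by
  have h := ha.bpt_lt ⟨0, by omega⟩
  simp only [bpt_zero] at h
  exact h.trans_le (ha.bpt_mono hk)

lemma IsProbVec.bpt_lt_one (ha : IsProbVec a) {k : ℕ} (hk : k < n) : bpt a k < 1 :=
  (ha.bpt_lt ⟨k, hk⟩).trans_le (ha.bpt_le_one hk)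

lemma IsProbVec.Dset_subset (ha : IsProbVec a) : Dset a ⊆ Ioo 0 1 := by
  rintro _ ⟨k, hk, hkn, rfl⟩
  exact ⟨ha.bpt_pos hk hkn.le, ha.bpt_lt_one hkn⟩

lemma IsProbVec.Jint_subset (ha : IsProbVec a) (i : Fin n) : Jint a i ⊆ Ico 0 1 :=
  fun _ hx => ⟨(ha.bpt_nonneg _).trans hx.1, hx.2.trans_le (ha.bpt_le_one i.2)⟩

lemma IsProbVec.exists_mem_Jint (ha : IsProbVec a) {x : ℝ} (hx : x ∈ Ico (0 : ℝ) 1) :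
    ∃ i, x ∈ Jint a i := by
  classical
  have hex : ∃ k, x < bpt a k := ⟨n, by rw [ha.bpt_last]; exact hx.2⟩
  have hle : Nat.find hex ≤ n := Nat.find_min' hex (by rw [ha.bpt_last]; exact hx.2)
  have hpos : 0 < Nat.find hex := by
    rw [Nat.pos_iff_ne_zero]
    intro h0
    have h := Nat.find_spec hex
    rw [h0, bpt_zero] at h
    exact absurd hx.1 (not_le.2 h)
  refine ⟨⟨Nat.find hex - 1, by omega⟩, ?_, ?_⟩
  · exact not_lt.1 (Nat.find_min hex (m := Nat.find hex - 1) (by omega))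
  · simp only [Nat.sub_add_cancel hpos]
    exact Nat.find_spec hex

lemma IsProbVec.Jint_unique (ha : IsProbVec a) {x : ℝ} {i j : Fin n} (hi : x ∈ Jint a i)
    (hj : x ∈ Jint a j) : i = j := by
  rcases lt_trichotomy i j with h | h | h
  · have := ha.bpt_mono (show (i : ℕ) + 1 ≤ j from h)
    linarith [hi.2, hj.1]
  · exact h
  · have := ha.bpt_mono (show (j : ℕ) + 1 ≤ i from h)
    linarith [hj.2, hi.1]

/-- The union of the open cells `(b_{i-1}, b_i)`. -/
def openCells (a : Fin n → ℝ) : Set ℝ := {x | ∃ i : Fin n, x ∈ Ioo (bpt a i) (bpt a ((i : ℕ) + 1))}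

lemma IsProbVec.mem_openCells (ha : IsProbVec a) {x : ℝ} :
    x ∈ openCells a ↔ x ∈ Ico (0 : ℝ) 1 ∧ x ≠ 0 ∧ x ∉ Dset a := by
  constructor
  · rintro ⟨i, hi⟩
    refine ⟨ha.Jint_subset i ⟨hi.1.le, hi.2⟩, ((ha.bpt_nonneg _).trans_lt hi.1).ne', ?_⟩
    rintro ⟨k, -, -, rfl⟩
    rcases Nat.lt_or_ge i k with h | h
    · exact absurd hi.2 (not_lt.2 (ha.bpt_mono h))
    · exact absurd hi.1 (not_lt.2 (ha.bpt_mono h))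
  · rintro ⟨hx, h0, hD⟩
    obtain ⟨i, hi⟩ := ha.exists_mem_Jint hx
    refine ⟨i, lt_of_le_of_ne hi.1 ?_, hi.2⟩
    intro h
    rcases Nat.eq_zero_or_pos i with hi0 | hi0
    · rw [hi0, bpt_zero] at h
      exact h0 h.symm
    · exact hD ⟨i, hi0, i.2, h.symm⟩

lemma IsProbVec.openCells_subset (ha : IsProbVec a) : openCells a ⊆ Ioo 0 1 := fun _ hx =>
  have h := ha.mem_openCells.1 hx
  ⟨lt_of_le_of_ne h.1.1 h.2.1.symm, h.1.2⟩

lemma IsProbVec.aperm (ha : IsProbVec a) (τ : Equiv.Perm (Fin n)) : IsProbVec (aperm a τ) :=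
  ⟨fun _ => ha.1 _, by rw [← ha.2]; exact Equiv.sum_comp τ.symm a⟩

lemma aperm_apply_perm (a : Fin n → ℝ) (τ : Equiv.Perm (Fin n)) (i : Fin n) :
    aperm a τ (τ i) = a i := by simp [aperm]

lemma aperm_aperm_symm (a : Fin n → ℝ) (τ : Equiv.Perm (Fin n)) :
    aperm (aperm a τ) τ.symm = a := by
  ext i
  simp [aperm]

end BreakPoints

section Exchange

variable {n : ℕ} {a : Fin n → ℝ} {τ : Equiv.Perm (Fin n)} {T : ℝ → ℝ}

lemma IsLrIET.mapsTo_Jint (hT : IsLrIET a τ T) {x : ℝ} {i : Fin n} (hx : x ∈ Jint a i) :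
    T x ∈ Jint (aperm a τ) (τ i) := by
  have h := hx
  rw [Jint, bpt_succ] at h ⊢
  rw [hT i x hx, aperm_apply_perm]
  constructor <;> linarith [h.1, h.2]

lemma IsLrIET.mapsTo_openCells (hT : IsLrIET a τ T) {x : ℝ} (hx : x ∈ openCells a) :
    T x ∈ openCells (aperm a τ) := by
  obtain ⟨i, hi⟩ := hx
  refine ⟨τ i, ?_⟩
  have h := hi
  rw [bpt_succ] at h ⊢
  rw [hT i x ⟨hi.1.le, hi.2⟩, aperm_apply_perm]
  constructor <;> linarith [h.1, h.2]

lemma IsLrIET.injOn (ha : IsProbVec a) (hT : IsLrIET a τ T) : InjOn T (Ico 0 1) := by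
  intro x hx y hy hxy
  obtain ⟨i, hi⟩ := ha.exists_mem_Jint hx
  obtain ⟨j, hj⟩ := ha.exists_mem_Jint hy
  have h1 := hT.mapsTo_Jint hi
  have h2 := hT.mapsTo_Jint hj
  rw [hxy] at h1
  obtain rfl := τ.injective ((ha.aperm τ).Jint_unique h1 h2)
  rw [hT i x hi, hT i y hj] at hxy
  linarith

lemma IsLrIET.eventually_eq_add (hT : IsLrIET a τ T) {x : ℝ}
    (hx : x ∈ openCells a) : ∀ᶠ y in 𝓝 x, y ∈ openCells a ∧ T y = T x + (y - x) := by
  obtain ⟨i, hi⟩ := hx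
  filter_upwards [isOpen_Ioo.mem_nhds hi] with y hy
  refine ⟨⟨i, hy⟩, ?_⟩
  rw [hT i x ⟨hi.1.le, hi.2⟩, hT i y ⟨hy.1.le, hy.2⟩]
  ring

/-- A closed set that is backward invariant under an interval exchange off its break points, and
contains an infinite forward orbit avoiding these, has no one-sided gap at the orbit's start. -/
lemma IsLrIET.no_gap (ha : IsProbVec a) (hT : IsLrIET a τ T) {K : Set ℝ} (hK : IsClosed K)
    (hback : ∀ z ∈ openCells a, T z ∈ K → z ∈ K) {p : ℕ → ℝ} (hpK : ∀ k, p k ∈ K)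
    (hpc : ∀ k, p k ∈ openCells a) (hps : ∀ k, p (k + 1) = T (p k))
    (hpi : Function.Injective p) {s : ℝ} (hs : s = 1 ∨ s = -1) {ε₀ : ℝ} (hε₀ : 0 < ε₀)
    (hgap : ∀ t ∈ Ioo 0 ε₀, p 0 + s * t ∉ K) : False := by
  have hfar : ∀ᶠ ε in 𝓝[>] (0 : ℝ), ∀ k ∈ Finset.range (n + 1), bpt a k ∉ K →
      ∀ z ∈ K, ε ≤ |z - bpt a k| := by
    rw [Filter.eventually_all_finset]
    intro k _
    by_cases hk : bpt a k ∈ K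
    · exact Eventually.of_forall fun _ h => absurd hk h
    obtain ⟨δ, hδ, hball⟩ := Metric.isOpen_iff.1 hK.isOpen_compl _ hk
    filter_upwards [Ioo_mem_nhdsGT hδ] with ε hε _ z hz
    by_contra! hlt
    exact hball (by rw [Metric.mem_ball, Real.dist_eq]; linarith [hε.2]) hz
  obtain ⟨ε, hfar, hε0, hεε₀⟩ := (hfar.and (Ioo_mem_nhdsGT hε₀)).exists
  have hgaps : ∀ k, ∀ t ∈ Ioo 0 ε, p k + s * t ∉ K := by
    intro k
    induction k with
    | zero => exact fun t ht => hgap t ⟨ht.1, ht.2.trans hεε₀⟩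
    | succ k ih =>
      intro t ht hmem
      obtain ⟨i, hi⟩ := hpc k
      have hbreak : ∀ j ∈ Finset.range (n + 1), ∀ t' ∈ Ioo 0 ε, bpt a j ≠ p k + s * t' := by
        intro j hj t' ht' heq
        have hjK : bpt a j ∉ K := heq ▸ ih t' ht'
        have h := hfar j hj hjK (p k) (hpK k)
        rw [heq] at h
        have : |p k - (p k + s * t')| = t' := by
          rcases hs with rfl | rfl
          · rw [show p k - (p k + 1 * t') = -t' by ring, abs_neg, abs_of_pos ht'.1]
          · rw [show p k - (p k + -1 * t') = t' by ring, abs_of_pos ht'.1]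
        linarith [ht'.2]
      have hcell : p k + s * t ∈ Ioo (bpt a i) (bpt a ((i : ℕ) + 1)) := by
        have hl := hbreak i (by simp)
        have hr := hbreak (i + 1) (by simp)
        rcases hs with rfl | rfl
        · refine ⟨by linarith [hi.1, ht.1], ?_⟩
          by_contra! hle
          exact hr (bpt a (i + 1) - p k) ⟨by linarith [hi.2], by linarith [ht.2]⟩ (by ring)
        · refine ⟨?_, by linarith [hi.2, ht.1]⟩
          by_contra! hle
          exact hl (p k - bpt a i) ⟨by linarith [hi.1], by linarith [ht.2]⟩ (by ring)
      refine ih t ht (hback _ ⟨i, hcell⟩ ?_)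
      rw [hps, hT i _ ⟨hi.1.le, hi.2⟩] at hmem
      rw [hT i _ ⟨hcell.1.le, hcell.2⟩]
      convert hmem using 1
      ring
  have hsep : ∀ k l, k ≠ l → ε ≤ |p k - p l| := by
    intro k l hkl
    by_contra! hlt
    have hne := hpi.ne hkl
    have h1 := hgaps k (s * (p l - p k))
    have h2 := hgaps l (s * (p k - p l))
    rw [abs_lt] at hlt
    have hss : s * s = 1 := by rcases hs with rfl | rfl <;> norm_num
    rw [← mul_assoc, hss, one_mul, add_sub_cancel] at h1 h2
    rcases lt_or_gt_of_ne hne with h | h <;> rcases hs with rfl | rfl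
    · exact h1 ⟨by linarith, by linarith⟩ (hpK l)
    · exact h2 ⟨by linarith, by linarith⟩ (hpK k)
    · exact h2 ⟨by linarith, by linarith⟩ (hpK k)
    · exact h1 ⟨by linarith, by linarith⟩ (hpK l)
  obtain ⟨_, -, φ, hφ, hlim⟩ := isCompact_Icc.tendsto_subseq
    (fun k => Ioo_subset_Icc_self (ha.openCells_subset (hpc k)))
  obtain ⟨N, hN⟩ := Metric.cauchySeq_iff.1 hlim.cauchySeq ε hε0
  have h := hN N le_rfl (N + 1) (Nat.le_succ N)
  rw [Real.dist_eq] at h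
  exact absurd h (not_lt.2 (hsep _ _ (hφ.injective.ne (Nat.succ_ne_self N).symm)))

end Exchange

/-- An irreducible interval exchange satisfying the Keane Condition, with its `ℤ`-iterates. -/
structure KeaneIET {n : ℕ} (a : Fin n → ℝ) (τ : Equiv.Perm (Fin n)) (T : ℝ → ℝ)
    (P : ℤ → ℝ → ℝ) : Prop where
  two_le : 2 ≤ n
  prob : IsProbVec a
  lr : IsLrIET a τ T
  iter : IsZIterLr T P
  irr : IrreduciblePerm τ
  keane : KeaneCond a T

namespace KeaneIET

variable {n : ℕ} {a : Fin n → ℝ} {τ : Equiv.Perm (Fin n)} {T : ℝ → ℝ} {P : ℤ → ℝ → ℝ}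

section Iterates

lemma iter_mem (h : KeaneIET a τ T P) {x : ℝ} (hx : x ∈ Ico (0 : ℝ) 1) (k : ℤ) :
    P k x ∈ Ico (0 : ℝ) 1 := (h.iter.2 k x hx).1

lemma iter_zero (h : KeaneIET a τ T P) {x : ℝ} (hx : x ∈ Ico (0 : ℝ) 1) : P 0 x = x :=
  h.iter.1 x hx

lemma iter_one (h : KeaneIET a τ T P) {x : ℝ} (hx : x ∈ Ico (0 : ℝ) 1) : P 1 x = T x := by
  have h1 := (h.iter.2 0 x hx).2
  rwa [zero_add, h.iter_zero hx] at h1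

lemma mapsTo_Ico (h : KeaneIET a τ T P) : MapsTo T (Ico 0 1) (Ico 0 1) := fun x hx => by
  rw [← h.iter_one hx]
  exact h.iter_mem hx 1

lemma iter_add_nat (h : KeaneIET a τ T P) {x : ℝ} (hx : x ∈ Ico (0 : ℝ) 1) (k : ℤ) (j : ℕ) :
    P (k + j) x = T^[j] (P k x) := by
  induction j with
  | zero => simp
  | succ j ih =>
    rw [Function.iterate_succ_apply', ← ih, Nat.cast_succ, ← add_assoc]
    exact (h.iter.2 _ x hx).2

lemma iterate_eq (h : KeaneIET a τ T P) {x : ℝ} (hx : x ∈ Ico (0 : ℝ) 1) (j : ℕ) :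
    T^[j] x = P j x := by
  have h1 := h.iter_add_nat hx 0 j
  rw [zero_add, h.iter_zero hx] at h1
  exact h1.symm

lemma iterate_injOn (h : KeaneIET a τ T P) (j : ℕ) : InjOn (T^[j]) (Ico 0 1) :=
  (h.lr.injOn h.prob).iterate h.mapsTo_Ico j

lemma iter_iter (h : KeaneIET a τ T P) {x : ℝ} (hx : x ∈ Ico (0 : ℝ) 1) (k l : ℤ) :
    P l (P k x) = P (k + l) x := by
  have hk := h.iter_mem hx k
  obtain ⟨j, rfl | rfl⟩ := l.eq_nat_or_neg
  · rw [h.iter_add_nat hx, h.iterate_eq hk]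
  · apply h.iterate_injOn j (h.iter_mem hk _) (h.iter_mem hx _)
    rw [← h.iter_add_nat hk, ← h.iter_add_nat hx, neg_add_cancel, neg_add_cancel_right,
      h.iter_zero hk]

lemma eq_iter_of_iter_eq (h : KeaneIET a τ T P) {x y : ℝ} (hx : x ∈ Ico (0 : ℝ) 1)
    (hy : y ∈ Ico (0 : ℝ) 1) {k l : ℤ} (hxy : P k x = P l y) : x = P (l - k) y := by
  have h1 := congrArg (P (-k)) hxy
  rwa [h.iter_iter hx, h.iter_iter hy, add_neg_cancel, h.iter_zero hx, ← sub_eq_add_neg] at h1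

lemma apply_iter (h : KeaneIET a τ T P) {x : ℝ} (hx : x ∈ Ico (0 : ℝ) 1) (k : ℤ) :
    T (P k x) = P (k + 1) x := (h.iter.2 k x hx).2.symm

lemma apply_iter_neg_one (h : KeaneIET a τ T P) {x : ℝ} (hx : x ∈ Ico (0 : ℝ) 1) :
    T (P (-1) x) = x := by
  rw [h.apply_iter hx, neg_add_cancel, h.iter_zero hx]

lemma iter_neg_one_apply (h : KeaneIET a τ T P) {x : ℝ} (hx : x ∈ Ico (0 : ℝ) 1) :
    P (-1) (T x) = x := by
  rw [← h.iter_one hx, h.iter_iter hx, add_neg_cancel, h.iter_zero hx]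

/-- The inverse of an interval exchange is an interval exchange. -/
lemma lr_inv (h : KeaneIET a τ T P) : IsLrIET (aperm a τ) τ.symm (P (-1)) := by
  intro j y hy
  have hyI := (h.prob.aperm τ).Jint_subset j hy
  obtain ⟨i, hi⟩ := h.prob.exists_mem_Jint (h.iter_mem hyI (-1))
  have h1 := h.lr.mapsTo_Jint hi
  have h2 := h.lr i _ hi
  rw [h.apply_iter_neg_one hyI] at h1 h2
  obtain rfl := (h.prob.aperm τ).Jint_unique h1 hy
  rw [aperm_aperm_symm, Equiv.symm_apply_apply]
  linarith

lemma apply_mem_openCells (h : KeaneIET a τ T P) {x : ℝ} (hx : x ∈ Ico (0 : ℝ) 1) :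
    T x ∈ openCells (aperm a τ) ↔ x ∈ openCells a := by
  refine ⟨fun hTx => ?_, fun hx => h.lr.mapsTo_openCells hx⟩
  have h1 := h.lr_inv.mapsTo_openCells hTx
  rwa [h.iter_neg_one_apply hx, aperm_aperm_symm] at h1

end Iterates

section Irreducible

lemma perm_zero_ne (h : KeaneIET a τ T P) (i : Fin n) (hi : (i : ℕ) = 0) :
    (τ i : ℕ) ≠ 0 := by
  intro h0
  refine h.irr 1 one_pos (by have := h.two_le; omega) ?_
  have hs : {i : Fin n | (i : ℕ) < 1} = {i} := by
    ext j
    simp only [mem_ofPred_eq, mem_singleton_iff, Fin.ext_iff]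
    omega
  rw [hs, image_singleton, singleton_eq_singleton_iff, Fin.ext_iff]
  omega

lemma perm_last_ne (h : KeaneIET a τ T P) (i : Fin n) (hi : (i : ℕ) + 1 = n) :
    (τ i : ℕ) + 1 ≠ n := by
  intro h0
  refine h.irr (n - 1) (by have := h.two_le; omega) (by have := h.two_le; omega) ?_
  have hs : {i : Fin n | (i : ℕ) < n - 1} = {i}ᶜ := by
    ext j
    simp only [mem_ofPred_eq, mem_compl_iff, mem_singleton_iff, Fin.ext_iff]
    omega
  have hτ : τ i = i := Fin.ext (by omega)
  rw [hs, image_compl_eq τ.bijective, image_singleton, hτ]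

lemma exists_apply_eq_zero (h : KeaneIET a τ T P) : ∃ b ∈ Dset a, T b = 0 := by
  have h0 : (0 : ℝ) ∈ Ico (0 : ℝ) 1 := ⟨le_rfl, one_pos⟩
  have hc := h.iter_mem h0 (-1)
  have hT0 := h.apply_iter_neg_one h0
  obtain ⟨i, hi⟩ := h.prob.exists_mem_Jint hc
  have hTi := h.lr i _ hi
  rw [hT0] at hTi
  have h1 := (h.prob.aperm τ).bpt_nonneg (τ i)
  have h2 := hi.1
  refine ⟨_, ⟨i, ?_, i.2, by linarith⟩, hT0⟩
  rw [Nat.pos_iff_ne_zero]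
  intro hi0
  have h3 := h.perm_zero_ne i hi0
  have h4 := (h.prob.aperm τ).bpt_pos (Nat.pos_of_ne_zero h3) (τ i).2.le
  linarith

lemma mem_Dset_of_apply_eq_zero (h : KeaneIET a τ T P) {x : ℝ} (hx : x ∈ Ico (0 : ℝ) 1)
    (hx0 : T x = 0) : x ∈ Dset a := by
  obtain ⟨b, hb, hb0⟩ := h.exists_apply_eq_zero
  rwa [h.lr.injOn h.prob hx (Ioo_subset_Ico_self (h.prob.Dset_subset hb)) (hx0.trans hb0.symm)]

lemma iterate_ne (h : KeaneIET a τ T P) {d e : ℝ} (hd : d ∈ Dset a) (he : e ∈ Dset a) {m : ℕ}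
    (hm : 0 < m) : T^[m] e ≠ d := fun heq =>
  (h.keane m hm).subset ⟨hd, e, he, heq⟩

lemma iterate_ne_self (h : KeaneIET a τ T P) {x : ℝ} (hx : x ∈ Ico (0 : ℝ) 1) {m : ℕ}
    (hm : 0 < m) : T^[m] x ≠ x := by
  intro hper
  have hmem : ∀ k, T^[k] x ∈ Ico (0 : ℝ) 1 := fun k => h.mapsTo_Ico.iterate k hx
  choose i hi using fun k => h.prob.exists_mem_Jint (hmem k)
  obtain ⟨k₀, hk₀, hmin⟩ := Finset.exists_min_image (Finset.range m)
    (fun k => T^[k] x - bpt a (i k)) ⟨0, by simpa using hm⟩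
  set t := T^[k₀] x - bpt a (i k₀) with ht
  have ht0 : 0 ≤ t := by linarith [(hi k₀).1]
  have hmove : ∀ k ≤ m, T^[k] (x - t) = T^[k] x - t := by
    intro k
    induction k with
    | zero => simp
    | succ k ih =>
      intro hk
      rw [Function.iterate_succ_apply', ih (by omega), Function.iterate_succ_apply']
      have hle := hmin k (by simp; omega)
      rw [h.lr (i k) _ (hi k), h.lr (i k) (T^[k] x - t) ⟨by linarith, by linarith [(hi k).2]⟩]
      ring
  simp only [Finset.mem_range] at hk₀
  have hqI : x - t ∈ Ico (0 : ℝ) 1 := by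
    have h1 := hmin 0 (by simpa using hm)
    have h2 := h.prob.bpt_nonneg (i 0)
    simp only [Function.iterate_zero, id] at h1
    exact ⟨by linarith, by linarith [hx.2]⟩
  have hper' : T^[m] (x - t) = x - t := by rw [hmove m le_rfl, hper]
  have hper'' : ∀ k, T^[m] (T^[k] (x - t)) = T^[k] (x - t) := fun k => by
    rw [← Function.iterate_add_apply, add_comm, Function.iterate_add_apply, hper']
  have hk : T^[k₀] (x - t) = bpt a (i k₀) := by
    rw [hmove k₀ hk₀.le, ht]
    ring
  have hperb : T^[m] (bpt a (i k₀)) = bpt a (i k₀) := hk ▸ hper'' k₀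
  rcases Nat.eq_zero_or_pos (i k₀) with h0 | h0
  · obtain ⟨b, hb, hb0⟩ := h.exists_apply_eq_zero
    have hbI := Ioo_subset_Ico_self (h.prob.Dset_subset hb)
    rw [h0, bpt_zero, ← hb0, ← Function.iterate_succ_apply, Function.iterate_succ_apply'] at hperb
    exact h.iterate_ne hb hb hm
      (h.lr.injOn h.prob (h.mapsTo_Ico.iterate m hbI) hbI hperb)
  · have hD : bpt a (i k₀) ∈ Dset a := ⟨i k₀, h0, (i k₀).2, rfl⟩
    exact h.iterate_ne hD hD hm hperb

lemma iter_injective (h : KeaneIET a τ T P) {x : ℝ} (hx : x ∈ Ico (0 : ℝ) 1) :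
    Function.Injective fun k => P k x := by
  have key : ∀ k l : ℤ, k < l → P k x ≠ P l x := by
    intro k l hkl heq
    have h1 := h.eq_iter_of_iter_eq hx hx heq
    obtain ⟨m, hm⟩ := Int.eq_ofNat_of_zero_le (show 0 ≤ l - k by omega)
    rw [hm, ← h.iterate_eq hx] at h1
    exact h.iterate_ne_self hx (by omega) h1.symm
  intro k l heq
  rcases lt_trichotomy k l with hkl | hkl | hkl
  · exact absurd heq (key k l hkl)
  · exact hkl
  · exact absurd heq.symm (key l k hkl)

lemma forward_mem_openCells (h : KeaneIET a τ T P) {p : ℝ} (hp : p ∈ Ioo (0 : ℝ) 1)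
    (hD : ∀ k : ℕ, P k p ∉ Dset a) (k : ℕ) : P k p ∈ openCells a := by
  have hpI := Ioo_subset_Ico_self hp
  refine h.prob.mem_openCells.2 ⟨h.iter_mem hpI k, ?_, hD k⟩
  cases k with
  | zero =>
    rw [Nat.cast_zero, h.iter_zero hpI]
    exact hp.1.ne'
  | succ k =>
    rw [Nat.cast_succ, ← h.apply_iter hpI]
    exact fun h0 => hD k (h.mem_Dset_of_apply_eq_zero (h.iter_mem hpI k) h0)

lemma backward_mem_openCells (h : KeaneIET a τ T P) {p : ℝ} (hp : p ∈ Ico (0 : ℝ) 1) {k₀ : ℕ}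
    (hD : P k₀ p ∈ Dset a) (k : ℕ) : P (-k) p ∈ openCells (aperm a τ) := by
  have key : ∀ e ∈ Dset a, ∀ m : ℕ, P (-(m + 1 : ℕ)) p ≠ e := by
    intro e he m hme
    have heI := Ioo_subset_Ico_self (h.prob.Dset_subset he)
    refine h.iterate_ne hD he (m := m + 1 + k₀) (by omega) ?_
    rw [h.iterate_eq heI, ← hme, h.iter_iter hp]
    congr 1
    push_cast
    ring
  have hw : P (-(k + 1 : ℕ)) p ∈ Ico (0 : ℝ) 1 := h.iter_mem hp _
  have hTw : T (P (-(k + 1 : ℕ)) p) = P (-k) p := by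
    rw [h.apply_iter hp]
    congr 1
    push_cast
    ring
  rw [← hTw, h.apply_mem_openCells hw, h.prob.mem_openCells]
  refine ⟨hw, fun h0 => ?_, fun hDw => key _ hDw k rfl⟩
  have hw' : P (-(k + 1 + 1 : ℕ)) p ∈ Ico (0 : ℝ) 1 := h.iter_mem hp _
  refine key _ (h.mem_Dset_of_apply_eq_zero hw' ?_) (k + 1) rfl
  rw [h.apply_iter hp, ← h0]
  congr 1

end Irreducible

section Recurrence

/-- The points whose orbit avoids `0` and stays away from `u` during times `-M, …, M`. -/
def avoiding (P : ℤ → ℝ → ℝ) (u r : ℝ) (M : ℕ) : Set ℝ :=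
  {x | x ∈ Ico (0 : ℝ) 1 ∧ (∀ k, P k x ≠ 0) ∧ ∀ k : ℤ, |k| ≤ M → r ≤ |P k x - u|}

lemma avoiding_subset (h : KeaneIET a τ T P) (u r : ℝ) (M : ℕ) :
    avoiding P u r M ⊆ Ioo 0 1 := fun x hx =>
  ⟨lt_of_le_of_ne hx.1.1 (by have h0 := hx.2.1 0; rwa [h.iter_zero hx.1, ne_comm] at h0), hx.1.2⟩

lemma avoiding_antitone (P : ℤ → ℝ → ℝ) (u r : ℝ) : Antitone (avoiding P u r) :=
  fun _ _ hMN _ hx => ⟨hx.1, hx.2.1, fun k hk => hx.2.2 k (hk.trans (by exact_mod_cast hMN))⟩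

lemma iter_mem_avoiding (h : KeaneIET a τ T P) {u r : ℝ} {M : ℕ} {x : ℝ}
    (hx : x ∈ avoiding P u r (M + 1)) {j : ℤ} (hj : |j| ≤ 1) : P j x ∈ avoiding P u r M := by
  refine ⟨h.iter_mem hx.1 j, fun k => ?_, fun k hk => ?_⟩
  · rw [h.iter_iter hx.1]
    exact hx.2.1 _
  · rw [h.iter_iter hx.1]
    refine hx.2.2 _ ((abs_add_le _ _).trans ?_)
    push_cast
    linarith

/-- The limit points of orbits staying away from `u` for longer and longer times. -/
def limitAvoiding (P : ℤ → ℝ → ℝ) (u r : ℝ) : Set ℝ := ⋂ M, closure (avoiding P u r M)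

lemma isClosed_limitAvoiding (P : ℤ → ℝ → ℝ) (u r : ℝ) : IsClosed (limitAvoiding P u r) :=
  isClosed_iInter fun _ => isClosed_closure

lemma limitAvoiding_subset (h : KeaneIET a τ T P) (u r : ℝ) :
    limitAvoiding P u r ⊆ Icc 0 1 :=
  (iInter_subset _ 0).trans
    (closure_minimal ((h.avoiding_subset u r 0).trans Ioo_subset_Icc_self) isClosed_Icc)

lemma notMem_limitAvoiding (h : KeaneIET a τ T P) {u r : ℝ} (hr : 0 < r) :
    u ∉ limitAvoiding P u r := by
  intro hu
  have hsub : avoiding P u r 0 ⊆ {x | r ≤ |x - u|} := fun x hx => by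
    have h0 := hx.2.2 0 (by simp)
    rwa [h.iter_zero hx.1] at h0
  have hcl : IsClosed {x : ℝ | r ≤ |x - u|} :=
    isClosed_le continuous_const (by fun_prop)
  have h1 : r ≤ |u - u| := closure_minimal hsub hcl (iInter_subset _ 0 hu)
  rw [sub_self, abs_zero] at h1
  linarith

lemma mem_limitAvoiding_of_eventually (h : KeaneIET a τ T P) {u r z w : ℝ}
    (hz : z ∈ limitAvoiding P u r) {j : ℤ} (hj : |j| ≤ 1)
    (hzw : ∀ᶠ x in 𝓝 z, x ∈ Ioo (0 : ℝ) 1 → P j x = w + (x - z)) :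
    w ∈ limitAvoiding P u r := by
  refine mem_iInter.2 fun M => ?_
  have h1 := mem_closure_iff_frequently.1 (mem_iInter.1 hz (M + 1))
  rw [mem_closure_iff_frequently]
  have hlim : Tendsto (fun x => w + (x - z)) (𝓝 z) (𝓝 w) := by
    have hc : ContinuousAt (fun x => w + (x - z)) z := by fun_prop
    simpa [ContinuousAt] using hc
  refine hlim.frequently ((h1.and_eventually hzw).mono fun x hx => ?_)
  rw [← hx.2 (h.avoiding_subset _ _ _ hx.1)]
  exact h.iter_mem_avoiding hx.1 hj

lemma apply_mem_limitAvoiding (h : KeaneIET a τ T P) {u r z : ℝ} (hzc : z ∈ openCells a)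
    (hz : z ∈ limitAvoiding P u r) : T z ∈ limitAvoiding P u r := by
  refine h.mem_limitAvoiding_of_eventually hz (j := 1) (by simp) ?_
  filter_upwards [h.lr.eventually_eq_add hzc] with x hx hxI
  rw [h.iter_one (Ioo_subset_Ico_self hxI), hx.2]

lemma iter_neg_one_mem_limitAvoiding (h : KeaneIET a τ T P) {u r z : ℝ}
    (hzc : z ∈ openCells (aperm a τ)) (hz : z ∈ limitAvoiding P u r) :
    P (-1) z ∈ limitAvoiding P u r := by
  refine h.mem_limitAvoiding_of_eventually hz (j := -1) (by simp) ?_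
  filter_upwards [h.lr_inv.eventually_eq_add hzc] with x hx _ using hx.2

lemma limitAvoiding_inter_nonempty (h : KeaneIET a τ T P) {u r : ℝ}
    (hne : ∀ M, (avoiding P u r M).Nonempty) : (limitAvoiding P u r ∩ Ioo 0 1).Nonempty := by
  have hcpt : IsCompact (closure (avoiding P u r 0)) :=
    isCompact_Icc.of_isClosed_subset isClosed_closure
      (closure_minimal ((h.avoiding_subset u r 0).trans Ioo_subset_Icc_self) isClosed_Icc)
  obtain ⟨z, hz⟩ := IsCompact.nonempty_iInter_of_sequence_nonempty_isCompact_isClosed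
    (fun M => closure (avoiding P u r M))
    (fun M => closure_mono (avoiding_antitone P u r (Nat.le_succ M)))
    (fun M => (hne M).closure) hcpt (fun M => isClosed_closure)
  have hzK : z ∈ limitAvoiding P u r := hz
  have hzI := h.limitAvoiding_subset u r hzK
  have hn := h.two_le
  have haτ := h.prob.aperm τ
  rcases hzI.1.eq_or_lt with h0 | h0
  · subst h0
    let i : Fin n := ⟨0, by omega⟩
    refine ⟨bpt (aperm a τ) (τ i), h.mem_limitAvoiding_of_eventually hzK (j := 1) (by simp) ?_,
      haτ.bpt_pos (Nat.pos_of_ne_zero (h.perm_zero_ne i rfl)) (τ i).2.le,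
      haτ.bpt_lt_one (τ i).2⟩
    have hpos : 0 < bpt a ((i : ℕ) + 1) := h.prob.bpt_pos (Nat.succ_pos _) i.2
    filter_upwards [Iio_mem_nhds hpos] with x hx hxI
    have hb0 : bpt a (i : ℕ) = 0 := bpt_zero a
    rw [h.iter_one (Ioo_subset_Ico_self hxI), h.lr i x ⟨by rw [hb0]; exact hxI.1.le, hx⟩, hb0]
    ring
  rcases hzI.2.eq_or_lt with h1 | h1
  · subst h1
    let i : Fin n := ⟨n - 1, by omega⟩
    have hi : (i : ℕ) + 1 = n := Nat.sub_add_cancel (by omega)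
    have hlast := h.perm_last_ne i hi
    have hlt := (τ i).2
    refine ⟨bpt (aperm a τ) (τ i + 1),
      h.mem_limitAvoiding_of_eventually hzK (j := 1) (by simp) ?_,
      haτ.bpt_pos (Nat.succ_pos _) hlt, haτ.bpt_lt_one (by omega)⟩
    have hb1 : bpt a ((i : ℕ) + 1) = 1 := by rw [hi, h.prob.bpt_last]
    have hlt1 : bpt a i < 1 := h.prob.bpt_lt_one i.2
    filter_upwards [Ioi_mem_nhds hlt1] with x hx hxI
    rw [h.iter_one (Ioo_subset_Ico_self hxI), h.lr i x ⟨le_of_lt hx, by rw [hb1]; exact hxI.2⟩,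
      bpt_succ, aperm_apply_perm]
    rw [bpt_succ] at hb1
    linarith
  · exact ⟨z, hzK, h0, h1⟩

/-- A closed set missing a point of an interval which it meets has a one-sided gap. -/
lemma exists_gap {K : Set ℝ} (hK : IsClosed K) {z u : ℝ} (hz : z ∈ K ∩ Ioo (0 : ℝ) 1)
    (hu : u ∈ Ioo (0 : ℝ) 1) (huK : u ∉ K) :
    ∃ p ∈ K ∩ Ioo (0 : ℝ) 1, ∃ s : ℝ, (s = 1 ∨ s = -1) ∧ ∃ ε > 0, ∀ t ∈ Ioo 0 ε,
      p + s * t ∉ K := by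
  rcases lt_trichotomy z u with hzu | rfl | hzu
  · obtain ⟨p, hp, hmax⟩ := (isCompact_Icc.inter_left hK : IsCompact (K ∩ Icc z u)).exists_isGreatest
      ⟨z, hz.1, le_rfl, hzu.le⟩
    have hpu : p < u := lt_of_le_of_ne hp.2.2 (fun hpu => huK (hpu ▸ hp.1))
    refine ⟨p, ⟨hp.1, hz.2.1.trans_le hp.2.1, hpu.trans hu.2⟩, 1, Or.inl rfl, u - p,
      sub_pos.2 hpu, fun t ht hmem => ?_⟩
    have := hmax ⟨hmem, by linarith [hp.2.1, ht.1], by linarith [ht.2]⟩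
    linarith [ht.1]
  · exact absurd hz.1 huK
  · obtain ⟨p, hp, hmin⟩ := (isCompact_Icc.inter_left hK : IsCompact (K ∩ Icc u z)).exists_isLeast
      ⟨z, hz.1, hzu.le, le_rfl⟩
    have hpu : u < p := lt_of_le_of_ne hp.2.1 (fun hpu => huK (hpu ▸ hp.1))
    refine ⟨p, ⟨hp.1, hu.1.trans hpu, hp.2.2.trans_lt hz.2.2⟩, -1, Or.inr rfl, p - u,
      sub_pos.2 hpu, fun t ht hmem => ?_⟩
    have := hmin ⟨hmem, by linarith [ht.2], by linarith [hp.2.2, ht.1]⟩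
    linarith [ht.1]

/-- Every orbit visits a given neighbourhood within a uniformly bounded time. -/
lemma exists_uniform_visit (h : KeaneIET a τ T P) {u r : ℝ} (hu : u ∈ Ioo (0 : ℝ) 1)
    (hr : 0 < r) : ∃ M : ℕ, ∀ x ∈ Ico (0 : ℝ) 1, (∀ k, P k x ≠ 0) →
      ∃ k : ℤ, |k| ≤ M ∧ |P k x - u| < r := by
  by_contra! hcon
  have hne : ∀ M, (avoiding P u r M).Nonempty := fun M => by
    obtain ⟨x, hx, hx0, hxk⟩ := hcon M
    exact ⟨x, hx, hx0, hxk⟩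
  have hK := isClosed_limitAvoiding P u r
  obtain ⟨z, hz⟩ := h.limitAvoiding_inter_nonempty hne
  obtain ⟨p, hp, s, hs, ε, hε, hgap⟩ := exists_gap hK hz hu (h.notMem_limitAvoiding hr)
  have hpI := Ioo_subset_Ico_self hp.2
  by_cases hD : ∃ k : ℕ, P k p ∈ Dset a
  · obtain ⟨k₀, hk₀⟩ := hD
    have hcell := h.backward_mem_openCells hpI hk₀
    have hstep : ∀ k : ℕ, P (-(k + 1 : ℕ)) p = P (-1) (P (-k) p) := fun k => by
      rw [h.iter_iter hpI]
      congr 1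
      push_cast
      ring
    refine h.lr_inv.no_gap (h.prob.aperm τ) hK (fun z hz hzK => ?_) (p := fun k => P (-k) p)
      (fun k => ?_) hcell hstep (fun k l hkl => ?_) hs hε ?_
    · have hzc := h.lr_inv.mapsTo_openCells hz
      rw [aperm_aperm_symm] at hzc
      have h1 := h.apply_mem_limitAvoiding hzc hzK
      rwa [h.apply_iter_neg_one
        (Ioo_subset_Ico_self ((h.prob.aperm τ).openCells_subset hz))] at h1
    · induction k with
      | zero => simpa [h.iter_zero hpI] using hp.1
      | succ k ih =>
        rw [hstep]
        exact h.iter_neg_one_mem_limitAvoiding (hcell k) ih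
    · have := h.iter_injective hpI hkl
      omega
    · simpa [h.iter_zero hpI] using hgap
  · push Not at hD
    have hcell := h.forward_mem_openCells hp.2 hD
    have hstep : ∀ k : ℕ, P (k + 1 : ℕ) p = T (P k p) := fun k => by
      rw [h.apply_iter hpI, Nat.cast_succ]
    refine h.lr.no_gap h.prob hK (fun z hz hzK => ?_) (p := fun k => P k p)
      (fun k => ?_) hcell hstep (fun k l hkl => ?_) hs hε ?_
    · have h1 := h.iter_neg_one_mem_limitAvoiding (h.lr.mapsTo_openCells hz) hzK
      rwa [h.iter_neg_one_apply (Ioo_subset_Ico_self (h.prob.openCells_subset hz))] at h1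
    · induction k with
      | zero => simpa [h.iter_zero hpI] using hp.1
      | succ k ih =>
        rw [hstep]
        exact h.apply_mem_limitAvoiding (hcell k) ih
    · have := h.iter_injective hpI hkl
      omega
    · simpa [h.iter_zero hpI] using hgap

end Recurrence

section Regular

variable {I : ℝ → ℤ → Fin n}

lemma mem_Ico_of_mem_Rset {x : ℝ} (hx : x ∈ Rset a P) : x ∈ Ico (0 : ℝ) 1 :=
  ⟨hx.1.1, lt_of_le_of_ne hx.1.2 fun h1 => hx.2 (Or.inl (Or.inr h1))⟩

lemma ne_iter_of_mem_Rset {x d : ℝ} (hx : x ∈ Rset a P) (hd : d ∈ Dset a) (k : ℤ) :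
    x ≠ P k d := fun hxd => hx.2 (Or.inr (mem_iUnion.2 ⟨k, d, hd, hxd.symm⟩))

lemma iter_ne_zero_of_mem_Rset (h : KeaneIET a τ T P) {x : ℝ} (hx : x ∈ Rset a P) (k : ℤ) :
    P k x ≠ 0 := by
  intro h0
  obtain ⟨b, hb, hb0⟩ := h.exists_apply_eq_zero
  have hbI := Ioo_subset_Ico_self (h.prob.Dset_subset hb)
  rw [← h.iter_one hbI] at hb0
  exact ne_iter_of_mem_Rset hx hb _
    (h.eq_iter_of_iter_eq (mem_Ico_of_mem_Rset hx) hbI (h0.trans hb0.symm))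

lemma iter_mem_Rset (h : KeaneIET a τ T P) {x : ℝ} (hx : x ∈ Rset a P) (k : ℤ) :
    P k x ∈ Rset a P := by
  have hxI := mem_Ico_of_mem_Rset hx
  have hmem := h.iter_mem hxI k
  refine ⟨Ico_subset_Icc_self hmem, ?_⟩
  rintro ((h0 | h1) | hD)
  · exact h.iter_ne_zero_of_mem_Rset hx k h0
  · exact hmem.2.ne h1
  · obtain ⟨j, d, hd, hjd⟩ := mem_iUnion.1 hD
    exact ne_iter_of_mem_Rset hx hd _ (h.eq_iter_of_iter_eq hxI
      (Ioo_subset_Ico_self (h.prob.Dset_subset hd)) hjd.symm)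

lemma mem_openCells_of_mem_Rset (h : KeaneIET a τ T P) {x : ℝ} (hx : x ∈ Rset a P) :
    x ∈ openCells a := by
  have hxI := mem_Ico_of_mem_Rset hx
  refine h.prob.mem_openCells.2 ⟨hxI, ?_, fun hD => ?_⟩
  · have h0 := h.iter_ne_zero_of_mem_Rset hx 0
    rwa [h.iter_zero hxI] at h0
  · exact ne_iter_of_mem_Rset hx hD 0 (h.iter_zero hxI).symm

lemma continuousAt_iter (h : KeaneIET a τ T P) {y : ℝ} (hy : y ∈ Rset a P) (k : ℤ) :
    ContinuousAt (P k) y := by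
  have hyI := mem_Ico_of_mem_Rset hy
  have hnear : ∀ᶠ x in 𝓝 y, x ∈ Ico (0 : ℝ) 1 :=
    mem_of_superset (isOpen_Ioo.mem_nhds (h.prob.openCells_subset (h.mem_openCells_of_mem_Rset hy)))
      Ioo_subset_Ico_self
  have hT : ∀ {b : Fin n → ℝ} {σ : Equiv.Perm (Fin n)} {F : ℝ → ℝ}, IsLrIET b σ F →
      ∀ {z}, z ∈ openCells b → ContinuousAt F z := by
    intro b σ F hF z hz
    have hc : ContinuousAt (fun x => F z + (x - z)) z := by fun_prop
    exact hc.congr ((hF.eventually_eq_add hz).mono fun x hx => hx.2.symm)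
  induction k with
  | zero => exact continuousAt_id.congr (hnear.mono fun x hx => (h.iter_zero hx).symm)
  | succ k ih =>
    have hc := (hT h.lr (h.mem_openCells_of_mem_Rset (h.iter_mem_Rset hy k))).comp ih
    exact hc.congr (hnear.mono fun x hx => h.apply_iter hx k)
  | pred k ih =>
    have hcell : P (-k) y ∈ openCells (aperm a τ) := by
      have h1 := h.lr.mapsTo_openCells
        (h.mem_openCells_of_mem_Rset (h.iter_mem_Rset hy (-k - 1)))
      rwa [h.apply_iter hyI, sub_add_cancel] at h1
    have hc := (hT h.lr_inv hcell).comp ih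
    exact hc.congr (hnear.mono fun x hx => h.iter_iter hx _ _)

lemma itin_iter (h : KeaneIET a τ T P) (hI : IsItin a P I) {x : ℝ} (hx : x ∈ Ico (0 : ℝ) 1)
    (k : ℤ) : I (P k x) = shiftZ k (I x) := by
  funext j
  rw [hI _ (h.iter_mem hx k), h.iter_iter hx, add_comm, ← hI x hx]
  rfl

lemma continuousAt_itin (h : KeaneIET a τ T P) (hI : IsItin a P I) {y : ℝ}
    (hy : y ∈ Rset a P) : ContinuousAt I y := by
  refine continuousAt_pi.2 fun k => ?_
  have hyI := mem_Ico_of_mem_Rset hy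
  obtain ⟨i, hi⟩ := h.mem_openCells_of_mem_Rset (h.iter_mem_Rset hy k)
  have hIy : I y k = i := (hI y hyI k i).2 ⟨hi.1.le, hi.2⟩
  rw [ContinuousAt, hIy]
  refine tendsto_nhds_of_eventually_eq ?_
  filter_upwards [(h.continuousAt_iter hy k).eventually (isOpen_Ioo.mem_nhds hi),
    isOpen_Ioo.mem_nhds (h.prob.openCells_subset (h.mem_openCells_of_mem_Rset hy))] with x hx hxI
  exact (hI x (Ioo_subset_Ico_self hxI) k i).2 ⟨hx.1.le, hx.2⟩

end Regular

section Subshift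

variable {I : ℝ → ℤ → Fin n}

lemma continuous_shiftZ (k : ℤ) : Continuous (shiftZ k : (ℤ → Fin n) → ℤ → Fin n) :=
  continuous_pi fun i => continuous_apply (i + k)

lemma shiftZ_mem_closure (h : KeaneIET a τ T P) (hI : IsItin a P I) {α : ℤ → Fin n}
    (hα : α ∈ closure (I '' Rset a P)) (k : ℤ) : shiftZ k α ∈ closure (I '' Rset a P) := by
  refine map_mem_closure (continuous_shiftZ k) hα ?_
  rintro _ ⟨x, hx, rfl⟩
  exact ⟨P k x, h.iter_mem_Rset hx k, h.itin_iter hI (mem_Ico_of_mem_Rset hx) k⟩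

lemma shiftS_image_closure (h : KeaneIET a τ T P) (hI : IsItin a P I) :
    shiftS '' closure (I '' Rset a P) = closure (I '' Rset a P) := by
  refine Subset.antisymm ?_ fun α hα => ?_
  · rintro _ ⟨α, hα, rfl⟩
    exact h.shiftZ_mem_closure hI hα 1
  · refine ⟨shiftZ (-1) α, h.shiftZ_mem_closure hI hα (-1), ?_⟩
    funext i
    simp [shiftS, shiftZ]

lemma closure_orbit_eq (h : KeaneIET a τ T P) (hI : IsItin a P I) {α : ℤ → Fin n}
    (hα : α ∈ closure (I '' Rset a P)) :
    closure {β : ℤ → Fin n | ∃ k : ℤ, shiftZ k α = β} = closure (I '' Rset a P) := by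
  refine Subset.antisymm (closure_minimal ?_ isClosed_closure)
    (closure_minimal ?_ isClosed_closure)
  · rintro _ ⟨k, rfl⟩
    exact h.shiftZ_mem_closure hI hα k
  rintro _ ⟨y, hy, rfl⟩
  rw [mem_closure_iff_nhds]
  intro V hV
  obtain ⟨C, hC, hCclosed, hCV⟩ := exists_mem_nhds_isClosed_subset hV
  obtain ⟨r, hr, hball⟩ := Metric.mem_nhds_iff.1 (h.continuousAt_itin hI hy hC)
  obtain ⟨M, hM⟩ := h.exists_uniform_visit
    (h.prob.openCells_subset (h.mem_openCells_of_mem_Rset hy)) hr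
  have hclosed : IsClosed (⋃ k ∈ Finset.Icc (-M : ℤ) M, shiftZ k ⁻¹' C) :=
    isClosed_biUnion_finset fun k _ => hCclosed.preimage (continuous_shiftZ k)
  have hsub : I '' Rset a P ⊆ ⋃ k ∈ Finset.Icc (-M : ℤ) M, shiftZ k ⁻¹' C := by
    rintro _ ⟨x, hx, rfl⟩
    have hxI := mem_Ico_of_mem_Rset hx
    obtain ⟨k, hk, hkr⟩ := hM x hxI (h.iter_ne_zero_of_mem_Rset hx)
    refine mem_iUnion₂.2 ⟨k, Finset.mem_Icc.2 (abs_le.1 hk), ?_⟩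
    rw [mem_preimage, ← h.itin_iter hI hxI]
    exact hball (by rwa [Metric.mem_ball, Real.dist_eq])
  obtain ⟨k, -, hk⟩ := mem_iUnion₂.1 (closure_minimal hsub hclosed hα)
  exact ⟨shiftZ k α, hCV hk, k, rfl⟩

end Subshift

end KeaneIET

/-- Corollary 4.3: if `T` is irreducible and satisfies the Keane
Condition then `(X,S)` is a minimal subshift: `X` is closed and shift-invariant,
and the closure of every `S`-orbit in `X` equals `X`. -/
theorem stmt11 {n : ℕ} (hn : 2 ≤ n) (a : Fin n → ℝ) (ha : IsProbVec a)
    (τ : Equiv.Perm (Fin n)) (T Tt : ℝ → ℝ)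
    (hT : IsLrIET a τ T) (hTt : IslRIET a τ Tt)
    (P Pt : ℤ → ℝ → ℝ) (hP : IsZIterLr T P) (hPt : IsZIterlR Tt Pt)
    (I It : ℝ → ℤ → Fin n) (hI : IsItin a P I) (hIt : IsItinDual a Pt It)
    (hirr : IrreduciblePerm τ) (hKeane : KeaneCond a T) :
    IsClosed (closure (I '' Rset a P)) ∧
    shiftS '' closure (I '' Rset a P) = closure (I '' Rset a P) ∧
    ∀ α ∈ closure (I '' Rset a P),
      closure {β : ℤ → Fin n | ∃ k : ℤ, shiftZ k α = β} = closure (I '' Rset a P) := by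
  have h : KeaneIET a τ T P := ⟨hn, ha, hT, hP, hirr, hKeane⟩
  exact ⟨isClosed_closure, h.shiftS_image_closure hI, fun _ hα => h.closure_orbit_eq hI hα⟩
end
end

section
/- Assume the Lr (a,τ) interval exchange transformation T has no periodic points (no x ∈ [0,1) and k ≥ 1 with T^k x = x). Then the itinerary maps 𝓘 and 𝓘̃ are injective. -/
open Set

noncomputable section

/-- If `S` acts along an orbit as a translation by one amount depending only on the piece `C i`
visited, and `x ≤ y` visit the same pieces, then every iterate of `S` translates `[x, y]`
rigidly. -/
theorem iterate_translates_of_common_itinerary {ι : Type*} {S : ℝ → ℝ} {C : ι → Set ℝ}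
    {t : ι → ℝ} (hC : ∀ i, (C i).OrdConnected) (hS : ∀ i, ∀ w ∈ C i, S w = w + t i)
    {x y : ℝ} (hxy : x ≤ y) {c : ℕ → ι} (hx : ∀ k, S^[k] x ∈ C (c k))
    (hy : ∀ k, S^[k] y ∈ C (c k)) (k : ℕ) :
    ∀ z ∈ Icc x y, S^[k] z = z + (S^[k] x - x) := by
  induction k with
  | zero => intro z _; simp
  | succ k ih =>
    intro z hz
    have hyk := ih y (right_mem_Icc.2 hxy)
    have hzk := ih z hz
    have hmem : S^[k] z ∈ C (c k) := by
      refine (hC (c k)).out (hx k) (hy k) ⟨?_, ?_⟩ <;> linarith [hz.1, hz.2]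
    rw [Function.iterate_succ_apply', Function.iterate_succ_apply', hS _ _ hmem, hS _ _ (hx k)]
    linarith

/-- A sequence in `[0, 1]` has two terms at distance less than a given positive number. -/
theorem exists_lt_abs_sub_lt {u : ℕ → ℝ} (hu : ∀ k, u k ∈ Icc (0 : ℝ) 1) {δ : ℝ} (hδ : 0 < δ) :
    ∃ k l, k < l ∧ |u l - u k| < δ := by
  have hfin : (Icc (0 : ℤ) ⌊1 / δ⌋).Finite := Set.finite_Icc _ _
  obtain ⟨k, l, hkl, h⟩ := hfin.exists_lt_map_eq_of_forall_mem (f := fun k => ⌊u k / δ⌋)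
    fun k => mem_Icc.2 ⟨Int.floor_nonneg.2 (div_nonneg (hu k).1 hδ.le),
      Int.floor_le_floor (div_le_div_of_nonneg_right (hu k).2 hδ.le)⟩
  refine ⟨k, l, hkl, ?_⟩
  have h1 := Int.abs_sub_lt_one_of_floor_eq_floor h.symm
  rwa [← sub_div, abs_div, abs_of_pos hδ, div_lt_one hδ] at h1

/-- If every iterate of `S` translates `[x, y]` rigidly and the orbit of `x` stays in `[0, 1]`,
then some iterate of `S` maps `[x, y]` into the fixed points of a further iterate. -/
theorem exists_iterate_fixes_of_translates {S : ℝ → ℝ} {x y : ℝ} (hxy : x < y)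
    (hS : ∀ k, ∀ z ∈ Icc x y, S^[k] z = z + (S^[k] x - x))
    (hb : ∀ k, S^[k] x ∈ Icc (0 : ℝ) 1) :
    ∃ k m : ℕ, 1 ≤ m ∧ ∀ z ∈ Icc x y, S^[m] (S^[k] z) = S^[k] z := by
  obtain ⟨k, l, hkl, hlt⟩ := exists_lt_abs_sub_lt hb (sub_pos.2 hxy)
  obtain ⟨m, rfl⟩ := Nat.exists_eq_add_of_lt hkl
  set p := m + 1 with hp
  set c := S^[k + m + 1] x - S^[k] x with hc
  refine ⟨k, p, by omega, ?_⟩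
  have hy := hS k y (right_mem_Icc.2 hxy.le)
  have key (j : ℕ) (z : ℝ) (hz : z ∈ Icc x y) : S^[j] (S^[k] z) = S^[k] z +
      (S^[j + k] x - S^[k] x) := by
    rw [← Function.iterate_add_apply, hS _ z hz, hS k z hz]; ring
  have hpk : p + k = k + m + 1 := by omega
  obtain ⟨h1, h2⟩ := abs_lt.1 hlt
  have hstep (j : ℕ) : S^[(j + p) + k] x = S^[j + k] x + c := by
    rcases le_total 0 c with h0 | h0
    · have hx' := hS k (x + c) ⟨by linarith, by linarith⟩
      have e1 := key j (x + c) ⟨by linarith, by linarith⟩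
      have e2 : S^[k] (x + c) = S^[k + m + 1] x := by rw [hx', hc]; ring
      rw [e2, ← Function.iterate_add_apply] at e1
      rw [show j + p + k = j + (k + m + 1) by omega, e1]
      linarith
    · have hy' := hS k (y + c) ⟨by linarith, by linarith⟩
      have e1 := key j (y + c) ⟨by linarith, by linarith⟩
      have e3 := hS (k + m + 1) y (right_mem_Icc.2 hxy.le)
      have e4 := hS (j + (k + m + 1)) y (right_mem_Icc.2 hxy.le)
      have e2 : S^[k] (y + c) = S^[k + m + 1] y := by rw [hy', e3, hc]; ring
      rw [e2, ← Function.iterate_add_apply] at e1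
      rw [show j + p + k = j + (k + m + 1) by omega]
      linarith
  have hmul (j : ℕ) : S^[j * p + k] x = S^[k] x + j * c := by
    induction j with
    | zero => simp
    | succ j ih =>
      rw [Nat.succ_mul, hstep, ih]; push_cast; ring
  have hc0 : c = 0 := by
    by_contra hne
    obtain ⟨j, hj⟩ := exists_nat_gt (1 / |c|)
    rw [div_lt_iff₀ (abs_pos.2 hne)] at hj
    have e1 := hb (j * p + k)
    have e2 := hb k
    rw [hmul] at e1
    have : |(j : ℝ) * c| ≤ 1 := abs_le.2 ⟨by linarith [e1.1, e2.2], by linarith [e1.2, e2.1]⟩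
    rw [abs_mul, Nat.abs_cast] at this
    linarith
  intro z hz
  rw [key p z hz, hpk, ← hc, hc0, add_zero]

/-- Nonnegative members of a family of `ℤ`-iterates are ordinary iterates. -/
theorem natCast_iterate_eq {T : ℝ → ℝ} {P : ℤ → ℝ → ℝ} {x : ℝ} (h0 : P 0 x = x)
    (hsucc : ∀ k : ℤ, P (k + 1) x = T (P k x)) (k : ℕ) : P k x = T^[k] x := by
  induction k with
  | zero => simpa using h0
  | succ k ih => rw [Function.iterate_succ_apply', ← ih, ← hsucc]; norm_cast

/-- An injectivity criterion on a set: two of its points in increasing order never agree. -/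
theorem injOn_of_lt_imp_ne {α β : Type*} [LinearOrder α] {f : α → β} {s : Set α}
    (h : ∀ x ∈ s, ∀ y ∈ s, x < y → f x ≠ f y) : Set.InjOn f s := by
  intro x hx y hy hf
  rcases lt_trichotomy x y with hlt | heq | hlt
  · exact absurd hf (h x hx y hy hlt)
  · exact heq
  · exact absurd hf.symm (h y hy x hx hlt)

/-- Theorem 4.4 (iv): if `T` has no periodic points, then the
itinerary maps `𝓘` and `𝓘̃` are injective. -/
theorem stmt14 {n : ℕ} (hn : 2 ≤ n) (a : Fin n → ℝ) (ha : IsProbVec a)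
    (τ : Equiv.Perm (Fin n)) (T Tt : ℝ → ℝ)
    (hT : IsLrIET a τ T) (hTt : IslRIET a τ Tt)
    (P Pt : ℤ → ℝ → ℝ) (hP : IsZIterLr T P) (hPt : IsZIterlR Tt Pt)
    (I It : ℝ → ℤ → Fin n) (hI : IsItin a P I) (hIt : IsItinDual a Pt It)
    (hnoper : ¬ ∃ x ∈ Set.Ico (0 : ℝ) 1, ∃ k : ℕ, 1 ≤ k ∧ T^[k] x = x) :
    Set.InjOn I (Set.Ico (0 : ℝ) 1) ∧ Set.InjOn It (Set.Ioc (0 : ℝ) 1) := by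
  have hS : ∀ i, ∀ w ∈ Jint a i, T w = w + (bpt (aperm a τ) (τ i : ℕ) - bpt a (i : ℕ)) := by
    intro i w hw; rw [hT i w hw]; ring
  have hSt : ∀ i, ∀ w ∈ Jtil a i, Tt w = w + (bpt (aperm a τ) (τ i : ℕ) - bpt a (i : ℕ)) := by
    intro i w hw; rw [hTt i w hw]; ring
  have hiter : ∀ x ∈ Ico (0 : ℝ) 1, ∀ k : ℕ, P k x = T^[k] x := fun x hx =>
    natCast_iterate_eq (hP.1 x hx) fun k => (hP.2 k x hx).2
  have hitert : ∀ x ∈ Ioc (0 : ℝ) 1, ∀ k : ℕ, Pt k x = Tt^[k] x := fun x hx =>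
    natCast_iterate_eq (hPt.1 x hx) fun k => (hPt.2 k x hx).2
  refine ⟨injOn_of_lt_imp_ne fun x hx y hy hxy hf => hnoper ?_,
    injOn_of_lt_imp_ne fun x hx y hy hxy hf => hnoper ?_⟩
  · have hxk (k : ℕ) : T^[k] x ∈ Jint a (I x k) := by
      rw [← hiter x hx]; exact (hI x hx k _).1 rfl
    have hyk (k : ℕ) : T^[k] y ∈ Jint a (I x k) := by
      rw [← hiter y hy, hf]; exact (hI y hy k _).1 rfl
    have htr := iterate_translates_of_common_itinerary (fun i => Set.ordConnected_Ico) hS hxy.le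
      (c := fun k => I x k) hxk hyk
    have hmem (k : ℕ) : T^[k] x ∈ Ico (0 : ℝ) 1 := by
      rw [← hiter x hx]; exact (hP.2 k x hx).1
    obtain ⟨k, m, hm, hfix⟩ :=
      exists_iterate_fixes_of_translates hxy htr fun k => Ico_subset_Icc_self (hmem k)
    exact ⟨T^[k] x, hmem k, m, hm, hfix x (left_mem_Icc.2 hxy.le)⟩
  · have hxk (k : ℕ) : Tt^[k] x ∈ Jtil a (It x k) := by
      rw [← hitert x hx]; exact (hIt x hx k _).1 rfl
    have hyk (k : ℕ) : Tt^[k] y ∈ Jtil a (It x k) := by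
      rw [← hitert y hy, hf]; exact (hIt y hy k _).1 rfl
    have htr := iterate_translates_of_common_itinerary (fun i => Set.ordConnected_Ioc) hSt hxy.le
      (c := fun k => It x k) hxk hyk
    have hmem {w : ℝ} (hw : w ∈ Ioc (0 : ℝ) 1) (k : ℕ) : Tt^[k] w ∈ Ioc (0 : ℝ) 1 := by
      rw [← hitert w hw]; exact (hPt.2 k w hw).1
    obtain ⟨k, m, hm, hfix⟩ :=
      exists_iterate_fixes_of_translates hxy htr fun k => Ioc_subset_Icc_self (hmem hx k)
    obtain ⟨z, hxz, hzy⟩ := exists_between hxy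
    have hz : z ∈ Icc x y := ⟨hxz.le, hzy.le⟩
    have hlt (j : ℕ) : Tt^[j] x < Tt^[j] z ∧ Tt^[j] z < Tt^[j] y := by
      rw [htr j z hz, htr j y (right_mem_Icc.2 hxy.le)]
      constructor <;> linarith
    -- Orbits of interior points avoid all division points, so `T` and `Tt` agree along them.
    have hagree (j : ℕ) : T (Tt^[j] z) = Tt (Tt^[j] z) := by
      have h1 := (hlt j).1
      have h2 := (hlt j).2
      have hx1 := (hxk j).1
      have hy2 := (hyk j).2
      rw [hS _ _ ⟨(hx1.trans h1).le, h2.trans_le hy2⟩, hSt _ _ ⟨hx1.trans h1, (h2.trans_le hy2).le⟩]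
    have hTz (j : ℕ) : T^[j] (Tt^[k] z) = Tt^[j] (Tt^[k] z) := by
      induction j with
      | zero => rfl
      | succ j ih =>
        rw [Function.iterate_succ_apply', ih, ← Function.iterate_add_apply, hagree,
          ← Function.iterate_succ_apply' Tt, ← Function.iterate_add_apply, Nat.succ_add]
    refine ⟨Tt^[k] z, ⟨?_, ?_⟩, m, hm, ?_⟩
    · exact ((hmem hx k).1.trans (hlt k).1).le
    · exact (hlt k).2.trans_le (hmem hy k).2
    · rw [hTz, hfix z hz]
end
end
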